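/- Let X be an ACM set of distinct points in ℙ^1 × ℙ^1 with α_X = (α_1,…,α_t). Then for all (i,j) ∈ ℕ², the Hilbert function of X is given by H_X(i,j) = Σ_{m=1}^{min(i+1, t)} min(j+1, α_m). -/

import Mathlib

open MvPolynomial

noncomputable section

namespace PaperMP

variable (K : Type) [Field K] [IsAlgClosed K] [CharZero K]
variable (k : ℕ) (n : Fin k → ℕ)

/-- Index type of the variables `x_{i,j}`, `1 ≤ i ≤ k`, `0 ≤ j ≤ n i`. -/
abbrev Sig := Σ i : Fin k, Fin (n i + 1)

/-- The `ℕ^k`-graded polynomial ring `R`. -/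
abbrev MPRing := MvPolynomial (Sig k n) K

/-- The grading of `R`: `deg x_{i,j} = e_i`. -/
def wt : Sig k n → (Fin k → ℕ) := fun p => Pi.single p.1 1

/-- A point of `ℙ^{n_1} × ⋯ × ℙ^{n_k}`. -/
abbrev MPPoint := ∀ i : Fin k, Projectivization K (Fin (n i + 1) → K)

/-- The affine cone over a point of multiprojective space. -/
def cone (P : MPPoint K k n) : Set (Sig k n → K) :=
  {x | ∀ i : Fin k, ∃ c : K, (fun j => x ⟨i, j⟩) = c • (P i).rep}

/-- Vanishing ideal of a set of points of affine space. -/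
def vanishingIdeal (T : Set (Sig k n → K)) : Ideal (MPRing K k n) :=
  ⨅ x ∈ T, RingHom.ker (MvPolynomial.eval x)

/-- The (prime) ideal `I_P` of a point of multiprojective space. -/
def idealOfPoint (P : MPPoint K k n) : Ideal (MPRing K k n) :=
  vanishingIdeal K k n (cone K k n P)

/-- The ideal `I_X` of a set of points of multiprojective space. -/
def idealOfSet (X : Set (MPPoint K k n)) : Ideal (MPRing K k n) :=
  ⨅ P ∈ X, idealOfPoint K k n P

/-- The Hilbert function of `R/I` in multidegree `d`. -/
def hilb (I : Ideal (MPRing K k n)) (d : Fin k → ℕ) : ℕ :=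
  Module.finrank K ((weightedHomogeneousSubmodule K (wt k n) d).map
    (Ideal.Quotient.mkₐ K I).toLinearMap)

/-- The irrelevant maximal ideal `m = (x_{1,0},…,x_{k,n_k})`. -/
def maxIdeal : Ideal (MPRing K k n) :=
  Ideal.span (Set.range (MvPolynomial.X : Sig k n → MPRing K k n))

/-- `L` is a regular sequence modulo `I`:  `(I,L) ⊆ m`, and each entry is a
non-zero divisor modulo `I` together with the previous entries. -/
def IsRegSeqMod (I : Ideal (MPRing K k n)) (L : List (MPRing K k n)) : Prop :=
  I ⊔ Ideal.span {f | f ∈ L} ≤ maxIdeal K k n ∧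
  ∀ i : Fin L.length, ∀ G : MPRing K k n,
    L.get i * G ∈ I ⊔ Ideal.span {f | f ∈ L.take i} →
      G ∈ I ⊔ Ideal.span {f | f ∈ L.take i}

/-- `depth R/I = l`: `l` is the length of a maximal regular sequence modulo `I`. -/
def hasDepth (I : Ideal (MPRing K k n)) (l : ℕ) : Prop :=
  IsGreatest {r : ℕ | ∃ L : List (MPRing K k n), L.length = r ∧ IsRegSeqMod K k n I L} l

/-- `X` is arithmetically Cohen–Macaulay: `depth R/I_X = K-dim R/I_X = k`. -/
def IsACM (X : Set (MPPoint K k n)) : Prop :=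
  hasDepth K k n (idealOfSet K k n X) k

/-! ### The first difference function -/

/-- Extend `H : ℕ^k → ℕ` by zero outside ℕ^k. -/
def extNeg (H : (Fin k → ℕ) → ℕ) (j : Fin k → ℤ) : ℤ :=
  if ∀ i, 0 ≤ j i then H (fun i => (j i).toNat) else 0

/-- The first difference function `ΔH` of a numerical function `H : ℕ^k → ℕ`. -/
def delta (H : (Fin k → ℕ) → ℕ) (d : Fin k → ℕ) : ℤ :=
  ∑ l : Fin k → Fin 2, (-1 : ℤ) ^ (∑ i, (l i : ℕ)) *
    extNeg k H (fun i => (d i : ℤ) - (l i : ℕ))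

/-! ### The ring `S = k[x_{1,1},…,x_{k,n_k}]` -/

/-- Index type of the variables `x_{i,j}`, `1 ≤ i ≤ k`, `1 ≤ j ≤ n i`. -/
abbrev SigS := Σ i : Fin k, Fin (n i)

/-- The `ℕ^k`-graded polynomial ring `S`. -/
abbrev SRing := MvPolynomial (SigS k n) K

/-- The grading of `S`: `deg x_{i,j} = e_i`. -/
def wtS : SigS k n → (Fin k → ℕ) := fun p => Pi.single p.1 1

/-- The Hilbert function of `S/J` in multidegree `d`. -/
def hilbS (J : Ideal (SRing K k n)) (d : Fin k → ℕ) : ℕ :=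
  Module.finrank K ((weightedHomogeneousSubmodule K (wtS k n) d).map
    (Ideal.Quotient.mkₐ K J).toLinearMap)

/-- `J` is an `ℕ^k`-homogeneous ideal of `S`. -/
def IsHomogIdealS (J : Ideal (SRing K k n)) : Prop :=
  ∀ f ∈ J, ∀ d : Fin k → ℕ, weightedHomogeneousComponent (wtS k n) d f ∈ J

/-- `J` is an artinian ideal of `S`: `√J = (x_{1,1},…,x_{k,n_k})`. -/
def IsArtinianIdealS (J : Ideal (SRing K k n)) : Prop :=
  J.radical = Ideal.span (Set.range (MvPolynomial.X : SigS k n → SRing K k n))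

/-! ### The ring `k[x_1,…,x_k]`, with `deg x_i = e_i` -/

abbrev TRing := MvPolynomial (Fin k) K

/-- The grading: `deg x_i = e_i`. -/
def wtT : Fin k → (Fin k → ℕ) := fun i => Pi.single i 1

/-- The Hilbert function of `k[x_1,…,x_k]/I` in multidegree `d`. -/
def hilbT (I : Ideal (TRing K k)) (d : Fin k → ℕ) : ℕ :=
  Module.finrank K ((weightedHomogeneousSubmodule K (wtT k) d).map
    (Ideal.Quotient.mkₐ K I).toLinearMap)

/-- `I` is an `ℕ^k`-homogeneous ideal of `k[x_1,…,x_k]`. -/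
def IsHomogIdealT (I : Ideal (TRing K k)) : Prop :=
  ∀ f ∈ I, ∀ d : Fin k → ℕ, weightedHomogeneousComponent (wtT k) d f ∈ I

/-- `I` is an artinian ideal of `k[x_1,…,x_k]`: `√I = (x_1,…,x_k)`. -/
def IsArtinianIdealT (I : Ideal (TRing K k)) : Prop :=
  I.radical = Ideal.span (Set.range (MvPolynomial.X : Fin k → TRing K k))

/-! ### Lifting monomial ideals -/

/-- The lift `m̄ = ∏_{i,j} ∏_{l=1}^{a_{i,j}} (x_{i,j} - (l-1) x_{i,0})` of the monomial
of `S` with exponent vector `b`, via the lifting matrix `𝒜`. -/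
def liftMonomial (b : SigS k n →₀ ℕ) : MPRing K k n :=
  ∏ p ∈ b.support, ∏ l ∈ Finset.range (b p),
    (MvPolynomial.X (⟨p.1, p.2.succ⟩ : Sig k n) - (l : MPRing K k n) * MvPolynomial.X ⟨p.1, 0⟩)

/-- `J` is a monomial ideal of `S`. -/
def IsMonomialIdeal (J : Ideal (SRing K k n)) : Prop :=
  ∃ A : Set (SigS k n →₀ ℕ), J = Ideal.span ((fun b => (monomial b (1 : K) : SRing K k n)) '' A)

/-- The exponent vectors of the minimal monomial generators of a monomial ideal `J ⊆ S`. -/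
def minGens (J : Ideal (SRing K k n)) : Set (SigS k n →₀ ℕ) :=
  {b | (monomial b (1 : K) : SRing K k n) ∈ J ∧
    ∀ b' : SigS k n →₀ ℕ, b' ≤ b → b' ≠ b → (monomial b' (1 : K) : SRing K k n) ∉ J}

/-- The lift to `R` of a monomial ideal `J ⊆ S`, generated by the lifts of the
minimal monomial generators of `J`. -/
def liftIdeal (J : Ideal (SRing K k n)) : Ideal (MPRing K k n) :=
  Ideal.span (liftMonomial K k n '' minGens K k n J)

/-- The projection `R → S ≅ R/(x_{1,0},…,x_{k,0})` sending `x_{i,0} ↦ 0` and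
`x_{i,j} ↦ x_{i,j}` for `j ≥ 1`. -/
def projToS : MPRing K k n →ₐ[K] SRing K k n :=
  aeval (fun p : Sig k n =>
    if h : p.2 = 0 then 0 else MvPolynomial.X (⟨p.1, p.2.pred h⟩ : SigS k n))

/-- The point `[1:b_{i,1}:⋯:b_{i,n_i}] × ⋯` of multiprojective space associated to the
exponent vector `b` of a monomial of `S`. -/
def monToPoint (b : SigS k n →₀ ℕ) : MPPoint K k n := fun i =>
  Projectivization.mk K
    (fun j : Fin (n i + 1) => if h : j = 0 then 1 else ((b ⟨i, j.pred h⟩ : ℕ) : K))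
    (fun hc => by simpa using congrFun hc 0)

/-! ### Partitions -/

/-- `lam` is a partition: positive non-increasing entries. -/
def IsPartition {t : ℕ} (lam : Fin t → ℕ) : Prop :=
  (∀ j, 0 < lam j) ∧ Antitone lam

/-- `lam` is a partition of `s`. -/
def IsPartitionOf (s : ℕ) {t : ℕ} (lam : Fin t → ℕ) : Prop :=
  IsPartition lam ∧ ∑ j, lam j = s

/-- The `(i+1)`-st entry `λ*_{i+1} = #{j : λ_j ≥ i+1}` of the conjugate partition. -/
def conjEntry {t : ℕ} (lam : Fin t → ℕ) (i : ℕ) : ℕ :=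
  (Finset.univ.filter fun j : Fin t => i + 1 ≤ lam j).card

/-- `β` is the conjugate partition `α*` of `α`. -/
def IsConjugateOf {t m : ℕ} (α : Fin t → ℕ) (β : Fin m → ℕ) : Prop :=
  (∀ i : Fin m, β i = conjEntry α i) ∧ ∀ i : ℕ, m ≤ i → conjEntry α i = 0

/-! ### `ℙ^1 × ℙ^1` -/

/-- A point of `ℙ^1`. -/
abbrev Proj1 := Projectivization K (Fin 2 → K)

/-- A point of `ℙ^1 × ℙ^1`. -/
abbrev Pt2 := MPPoint K 2 (fun _ => 1)

/-- The coordinate ring of `ℙ^1 × ℙ^1`. -/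
abbrev R2 := MPRing K 2 (fun _ => 1)

/-- `P` enumerates the distinct first coordinates of `X` and `α` lists the sizes of the
corresponding fibers, in non-increasing order; so `α = α_X`. -/
def IsAlphaLabel (X : Set (Pt2 K)) {t : ℕ} (P : Fin t → Proj1 K) (α : Fin t → ℕ) : Prop :=
  Function.Injective P ∧ (Set.range P = (fun Z : Pt2 K => Z 0) '' X) ∧
  (∀ i, α i = Set.ncard {Z | Z ∈ X ∧ Z 0 = P i}) ∧ Antitone α

/-- `Q` enumerates the distinct second coordinates of `X` and `β` lists the sizes of the
corresponding fibers, in non-increasing order; so `β = β_X`. -/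
def IsBetaLabel (X : Set (Pt2 K)) {r : ℕ} (Q : Fin r → Proj1 K) (β : Fin r → ℕ) : Prop :=
  Function.Injective Q ∧ (Set.range Q = (fun Z : Pt2 K => Z 1) '' X) ∧
  (∀ i, β i = Set.ncard {Z | Z ∈ X ∧ Z 1 = Q i}) ∧ Antitone β

/-- `α = α_X`. -/
def IsAlphaPartition (X : Set (Pt2 K)) {t : ℕ} (α : Fin t → ℕ) : Prop :=
  ∃ P : Fin t → Proj1 K, IsAlphaLabel K X P α

/-- `β = β_X`. -/
def IsBetaPartition (X : Set (Pt2 K)) {r : ℕ} (β : Fin r → ℕ) : Prop :=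
  ∃ Q : Fin r → Proj1 K, IsBetaLabel K X Q β

/-- `F` is "the" form of degree `(1,0)` vanishing at all points of `ℙ^1 × ℙ^1` whose
first coordinate is `P`. -/
def IsForm1Of (P : Proj1 K) (F : R2 K) : Prop :=
  IsWeightedHomogeneous (wt 2 (fun _ => 1)) F (Pi.single 0 1) ∧ F ≠ 0 ∧
  ∀ x : Sig 2 (fun _ => 1) → K,
    (∃ c : K, (fun j : Fin 2 => x ⟨0, j⟩) = c • P.rep) → MvPolynomial.eval x F = 0

/-- `F` is "the" form of degree `(0,1)` vanishing at all points of `ℙ^1 × ℙ^1` whose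
second coordinate is `P`. -/
def IsForm2Of (P : Proj1 K) (F : R2 K) : Prop :=
  IsWeightedHomogeneous (wt 2 (fun _ => 1)) F (Pi.single 1 1) ∧ F ≠ 0 ∧
  ∀ x : Sig 2 (fun _ => 1) → K,
    (∃ c : K, (fun j : Fin 2 => x ⟨1, j⟩) = c • P.rep) → MvPolynomial.eval x F = 0

end PaperMP

namespace PaperMP

section RegularSequences

variable {k R T : Type*} [CommRing k] [CommRing R] [CommRing T] [Algebra k R] [Algebra k T]

theorem mem_ker_sup_span_singleton (φ : R →ₐ[k] T) (L F : R) :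
    F ∈ RingHom.ker φ ⊔ Ideal.span {L} ↔ ∃ H, φ F = φ L * φ H := by
  constructor
  · intro h
    obtain ⟨x, hx, y, hy, rfl⟩ := Submodule.mem_sup.1 h
    obtain ⟨H, rfl⟩ := Ideal.mem_span_singleton'.1 hy
    exact ⟨H, by rw [map_add, RingHom.mem_ker.1 hx, zero_add, map_mul, mul_comm]⟩
  · rintro ⟨H, hH⟩
    rw [← sub_add_cancel F (H * L)]
    refine Submodule.add_mem_sup ?_ (Ideal.mem_span_singleton'.2 ⟨H, rfl⟩)
    rw [RingHom.mem_ker, map_sub, hH, map_mul, mul_comm, sub_self]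

/-- If `F₁, F₂` is a regular sequence on the image of `φ` and `L` is a non-zero divisor, then no
non-zero element of the quotient by `L` is killed by both `F₁` and `F₂`. -/
theorem mem_ker_sup_span_of_regular (φ : R →ₐ[k] T) {F₁ F₂ L : R}
    (h₁ : ∀ G, F₁ * G ∈ RingHom.ker φ → G ∈ RingHom.ker φ)
    (h₂ : ∀ G, F₂ * G ∈ RingHom.ker φ ⊔ Ideal.span {F₁} → G ∈ RingHom.ker φ ⊔ Ideal.span {F₁})
    (hL : ∀ x, φ L * x = 0 → x = 0) {G : R}
    (hG₁ : F₁ * G ∈ RingHom.ker φ ⊔ Ideal.span {L})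
    (hG₂ : F₂ * G ∈ RingHom.ker φ ⊔ Ideal.span {L}) :
    G ∈ RingHom.ker φ ⊔ Ideal.span {L} := by
  obtain ⟨H, hH⟩ := (mem_ker_sup_span_singleton φ L _).1 hG₁
  obtain ⟨y, hy⟩ := (mem_ker_sup_span_singleton φ L _).1 hG₂
  rw [map_mul] at hH hy
  have hF : φ (F₂ * H) = φ F₁ * φ y := by
    refine sub_eq_zero.1 (hL _ ?_)
    rw [map_mul]
    linear_combination φ F₁ * hy - φ F₂ * hH
  obtain ⟨H', hH'⟩ := (mem_ker_sup_span_singleton φ F₁ _).1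
    (h₂ H ((mem_ker_sup_span_singleton φ F₁ _).2 ⟨y, hF⟩))
  have := h₁ (G - L * H') (by
    rw [RingHom.mem_ker, map_mul, map_sub, map_mul]
    linear_combination hH + φ L * hH')
  refine (mem_ker_sup_span_singleton φ L _).2 ⟨H', ?_⟩
  rw [RingHom.mem_ker, map_sub, map_mul] at this
  linear_combination this

theorem mem_of_pow_mul_mem {J : Ideal R} {v G : R} {N : ℕ} (hN : v ^ N * G ∈ J)
    (h : ∀ k, v * (v ^ k * G) ∈ J → v ^ k * G ∈ J) : G ∈ J := by
  induction N with
  | zero => simpa using hN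
  | succ N ih => exact ih (h N (by rwa [← mul_assoc, ← pow_succ']))

/-- If `R / J` has no socle, then `L₁` is a non-zero divisor modulo `J`. -/
theorem mem_of_mul_mem_of_socle_eq_bot {J : Ideal R} {L₀ L₁ v₀ v₁ : R} {M N : ℕ}
    (hL₀ : L₀ ∈ J) (hv₀ : v₀ ^ M ∈ J) (hv₁ : v₁ ^ N ∈ J ⊔ Ideal.span {L₁})
    (hs : ∀ G, (∀ F ∈ ({L₀, v₀, L₁, v₁} : Set R), F * G ∈ J) → G ∈ J)
    {G : R} (hG : L₁ * G ∈ J) : G ∈ J := by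
  have key : ∀ G, L₁ * G ∈ J → v₁ * G ∈ J → G ∈ J := by
    intro G h₁ h₂
    refine mem_of_pow_mul_mem (v := v₀) (J.mul_mem_right G hv₀) fun k hk => hs _ ?_
    rintro F (rfl | rfl | rfl | rfl)
    · exact J.mul_mem_right _ hL₀
    · exact hk
    · rw [mul_left_comm]; exact J.mul_mem_left _ h₁
    · rw [mul_left_comm]; exact J.mul_mem_left _ h₂
  have hN : v₁ ^ N * G ∈ J := by
    obtain ⟨x, hx, y, hy, hxy⟩ := Submodule.mem_sup.1 hv₁
    obtain ⟨z, rfl⟩ := Ideal.mem_span_singleton'.1 hy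
    rw [← hxy, add_mul, mul_assoc]
    exact J.add_mem (J.mul_mem_right _ hx) (J.mul_mem_left _ hG)
  refine mem_of_pow_mul_mem hN fun k hk => key _ ?_ hk
  rw [mul_left_comm]
  exact J.mul_mem_left _ hG

end RegularSequences

section PowSpan

variable {K A : Type*} [Field K] [CommRing A] [Algebra K A]

/-- The span of the monomials `a ^ k * b ^ l` with `k < i` and `l < j`. -/
def powSpan (K : Type*) {A : Type*} [Field K] [CommRing A] [Algebra K A] (a b : A) (i j : ℕ) :
    Submodule K A :=
  Submodule.span K {x | ∃ k < i, ∃ l < j, a ^ k * b ^ l = x}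

theorem pow_mul_pow_mem_powSpan (a b : A) {i j k l : ℕ} (hk : k < i) (hl : l < j) :
    a ^ k * b ^ l ∈ powSpan K a b i j :=
  Submodule.subset_span ⟨k, hk, l, hl, rfl⟩

theorem powSpan_mono (a b : A) {i j i' j' : ℕ} (hi : i ≤ i') (hj : j ≤ j') :
    powSpan K a b i j ≤ powSpan K a b i' j' :=
  Submodule.span_mono fun _ ⟨k, hk, l, hl, h⟩ => ⟨k, hk.trans_le hi, l, hl.trans_le hj, h⟩

theorem powSpan_zero_left (a b : A) (j : ℕ) : powSpan K a b 0 j = ⊥ := by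
  simp [powSpan]

theorem powSpan_zero_right (a b : A) (i : ℕ) : powSpan K a b i 0 = ⊥ := by
  simp [powSpan]

theorem mul_left_mem_powSpan (a b : A) {i j : ℕ} {x : A} (hx : x ∈ powSpan K a b i j) :
    a * x ∈ powSpan K a b (i + 1) j := by
  induction hx using Submodule.span_induction with
  | mem x h =>
    obtain ⟨k, hk, l, hl, rfl⟩ := h
    rw [← mul_assoc, ← pow_succ']
    exact pow_mul_pow_mem_powSpan a b (by omega) hl
  | zero => simp
  | add x y _ _ hx hy => rw [mul_add]; exact add_mem hx hy
  | smul c x _ hx => rw [mul_smul_comm]; exact Submodule.smul_mem _ _ hx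

theorem powSpan_comm (a b : A) (i j : ℕ) : powSpan K a b i j = powSpan K b a j i := by
  unfold powSpan
  congr 1
  ext x
  constructor <;> rintro ⟨k, hk, l, hl, rfl⟩ <;> exact ⟨l, hl, k, hk, mul_comm _ _⟩

theorem mul_right_mem_powSpan (a b : A) {i j : ℕ} {x : A} (hx : x ∈ powSpan K a b i j) :
    b * x ∈ powSpan K a b i (j + 1) := by
  rw [powSpan_comm] at hx ⊢
  exact mul_left_mem_powSpan b a hx

theorem powSpan_succ_succ (a b : A) (i j : ℕ) :
    powSpan K a b (i + 1) (j + 1) =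
      powSpan K a b i (j + 1) ⊔ powSpan K a b (i + 1) j ⊔ Submodule.span K {a ^ i * b ^ j} := by
  apply le_antisymm
  · refine Submodule.span_le.2 ?_
    rintro _ ⟨k, hk, l, hl, rfl⟩
    rcases Nat.lt_succ_iff_lt_or_eq.1 hk with hk' | rfl
    · exact Submodule.mem_sup_left
        (Submodule.mem_sup_left (pow_mul_pow_mem_powSpan a b hk' hl))
    rcases Nat.lt_succ_iff_lt_or_eq.1 hl with hl' | rfl
    · exact Submodule.mem_sup_left
        (Submodule.mem_sup_right (pow_mul_pow_mem_powSpan a b hk hl'))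
    · exact Submodule.mem_sup_right (Submodule.mem_span_singleton_self _)
  · refine sup_le (sup_le (powSpan_mono a b (by omega) le_rfl)
      (powSpan_mono a b le_rfl (by omega))) ?_
    rw [Submodule.span_singleton_le_iff_mem]
    exact pow_mul_pow_mem_powSpan a b (by omega) (by omega)

open Classical in
/-- `1` if `a ^ i * b ^ j` is not a combination of the monomials `a ^ k * b ^ l` with
`k ≤ i`, `l ≤ j`, `(k, l) ≠ (i, j)`, and `0` otherwise. -/
def powJump (K : Type*) {A : Type*} [Field K] [CommRing A] [Algebra K A] (a b : A) (i j : ℕ) : ℕ :=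
  if a ^ i * b ^ j ∈ powSpan K a b i (j + 1) ⊔ powSpan K a b (i + 1) j then 0 else 1

theorem powJump_le_one (a b : A) (i j : ℕ) : powJump K a b i j ≤ 1 := by
  unfold powJump; split_ifs <;> omega

theorem powJump_antitone_left (a b : A) (j : ℕ) : Antitone fun i => powJump K a b i j := by
  refine antitone_nat_of_succ_le fun i => ?_
  unfold powJump
  split_ifs with h₁ h₂ h₃ <;> try omega
  refine absurd ?_ h₁
  obtain ⟨x, hx, y, hy, hxy⟩ := Submodule.mem_sup.1 h₃
  rw [pow_succ', mul_assoc, ← hxy, mul_add]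
  exact Submodule.add_mem_sup (mul_left_mem_powSpan a b hx) (mul_left_mem_powSpan a b hy)

open Classical in
theorem finrank_sup_span_singleton {V : Type*} [AddCommGroup V] [Module K V]
    [FiniteDimensional K V] (S : Submodule K V) (v : V) :
    Module.finrank K ↥(S ⊔ Submodule.span K {v}) =
      Module.finrank K S + if v ∈ S then 0 else 1 := by
  split_ifs with h
  · rw [sup_eq_left.2 ((Submodule.span_singleton_le_iff_mem _ _).2 h), add_zero]
  · have hv : v ≠ 0 := fun h0 => h (h0 ▸ S.zero_mem)
    have hd : S ⊓ Submodule.span K {v} = ⊥ :=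
      ((Submodule.disjoint_span_singleton' hv).2 h).eq_bot
    have := Submodule.finrank_sup_add_finrank_inf_eq S (Submodule.span K {v})
    rwa [hd, finrank_bot, add_zero, finrank_span_singleton hv] at this

variable [FiniteDimensional K A]

theorem finrank_powSpan_succ_right (a b : A)
    (h : ∀ i j, powSpan K a b i (j + 1) ⊓ powSpan K a b (i + 1) j ≤ powSpan K a b i j)
    (i j : ℕ) :
    Module.finrank K (powSpan K a b i (j + 1)) =
      Module.finrank K (powSpan K a b i j) + ∑ k ∈ Finset.range i, powJump K a b k j := by
  induction i with
  | zero => rw [powSpan_zero_left, powSpan_zero_left]; simp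
  | succ i ih =>
    have h₁ := finrank_sup_span_singleton (K := K)
      (powSpan K a b i (j + 1) ⊔ powSpan K a b (i + 1) j) (a ^ i * b ^ j)
    have h₂ := Submodule.finrank_sup_add_finrank_inf_eq
      (powSpan K a b i (j + 1)) (powSpan K a b (i + 1) j)
    rw [(h i j).antisymm (le_inf (powSpan_mono a b le_rfl (by omega))
      (powSpan_mono a b (by omega) le_rfl))] at h₂
    rw [← powSpan_succ_succ] at h₁
    rw [Finset.sum_range_succ]
    change _ = _ + powJump K a b i j at h₁
    omega

theorem sum_range_eq_min_of_antitone {D : ℕ → ℕ} (hD : Antitone D) (h1 : ∀ i, D i ≤ 1)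
    {i T : ℕ} (hi : i ≤ T) :
    ∑ k ∈ Finset.range i, D k = min i (∑ k ∈ Finset.range T, D k) := by
  have hle : ∑ k ∈ Finset.range i, D k ≤ ∑ k ∈ Finset.range T, D k :=
    Finset.sum_le_sum_of_subset (Finset.range_mono hi)
  by_cases h : ∀ k < i, D k = 1
  · have : ∑ k ∈ Finset.range i, D k = i := by
      rw [Finset.sum_congr rfl fun k hk => h k (Finset.mem_range.1 hk)]; simp
    omega
  · push Not at h
    obtain ⟨k, hk, hk1⟩ := h
    have hk0 : D k = 0 := by have := h1 k; omega
    have h₁ : ∑ k ∈ Finset.range i, D k = ∑ k ∈ Finset.range T, D k := by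
      refine Finset.sum_subset (Finset.range_mono hi) fun l _ hl => ?_
      have := hD (show k ≤ l by simp at hl; omega)
      omega
    have h₂ : ∑ k ∈ Finset.range i, D k ≤ i := by
      simpa using Finset.sum_le_sum fun k (_ : k ∈ Finset.range i) => h1 k
    omega

/-- The dimensions of the spaces `powSpan K a b i j` are determined by those with `i` large. -/
theorem finrank_powSpan_eq_sum_min (a b : A)
    (h : ∀ i j, powSpan K a b i (j + 1) ⊓ powSpan K a b (i + 1) j ≤ powSpan K a b i j)
    {t : ℕ} {α : Fin t → ℕ} (hα : Antitone α)
    (ht : ∀ i j, t ≤ i → Module.finrank K (powSpan K a b i j) = ∑ m, min j (α m)) (i j : ℕ) :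
    Module.finrank K (powSpan K a b i j) =
      ∑ m ∈ Finset.range (min i t), min j (if h : m < t then α ⟨m, h⟩ else 0) := by
  set β : ℕ → ℕ := fun m => if h : m < t then α ⟨m, h⟩ else 0 with hβ
  have hβa : Antitone β := by
    intro m m' hm
    simp only [hβ]
    split_ifs with h₁ h₂
    · exact hα hm
    · omega
    · exact Nat.zero_le _
    · exact le_rfl
  have step : ∀ m j, min (j + 1) (β m) = min j (β m) + if j < β m then 1 else 0 := by
    intro m j; split_ifs <;> omega
  have hsum : ∀ j, ∑ m, min j (α m) = ∑ m ∈ Finset.range t, min j (β m) := by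
    intro j
    rw [← Fin.sum_univ_eq_sum_range (fun m => min j (β m))]
    exact Finset.sum_congr rfl fun m _ => by simp [hβ]
  have hJ : ∀ j T, t ≤ T → ∑ k ∈ Finset.range T, powJump K a b k j =
      ∑ m ∈ Finset.range t, if j < β m then 1 else 0 := by
    intro j T hT
    have := finrank_powSpan_succ_right a b h T j
    rw [ht T _ hT, ht T _ hT, hsum, hsum, Finset.sum_congr rfl fun m _ => step m j,
      Finset.sum_add_distrib] at this
    omega
  induction j with
  | zero => simp [powSpan_zero_right]
  | succ j ih =>
    rw [finrank_powSpan_succ_right a b h, ih, Finset.sum_congr rfl fun m _ => step m j,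
      Finset.sum_add_distrib]
    congr 1
    rw [sum_range_eq_min_of_antitone (powJump_antitone_left a b j)
      (fun i => powJump_le_one a b i j) (Nat.le_add_right i t), hJ j _ (Nat.le_add_left t i),
      sum_range_eq_min_of_antitone (D := fun m => if j < β m then 1 else 0) _ _
        (Nat.min_le_right i t)]
    · have : (∑ m ∈ Finset.range t, if j < β m then 1 else 0) ≤ t := by
        simpa using Finset.sum_le_sum fun m (_ : m ∈ Finset.range t) =>
          (show (if j < β m then 1 else 0) ≤ 1 by split_ifs <;> omega)
      omega
    · intro m m' hm
      have := hβa hm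
      dsimp only
      split_ifs <;> omega
    · intro m
      split_ifs <;> omega

end PowSpan

section Fibers

theorem aeval_mul_mem_powSpan {K A : Type*} [Field K] [CommRing A] [Algebra K A] (a b : A)
    {i j l : ℕ} (p : Polynomial K) (hp : p.natDegree < i) (hl : l < j) :
    Polynomial.aeval a p * b ^ l ∈ powSpan K a b i j := by
  rw [Polynomial.aeval_eq_sum_range, Finset.sum_mul]
  refine Submodule.sum_mem _ fun k hk => ?_
  rw [smul_mul_assoc]
  exact Submodule.smul_mem _ _
    (pow_mul_pow_mem_powSpan a b (by simp at hk; omega) hl)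

variable {K Y : Type*} [Field K] {t : ℕ} (f : Y → Fin t) (b : Y → K)

/-- The `l`-th power of `b` on the fiber of `f` over `m`, extended by zero. -/
def fiberPow (m : Fin t) (l : ℕ) : Y → K := fun x => if f x = m then b x ^ l else 0

theorem powSpan_eq_span_fiberPow {a : Y → K} {e : Fin t → K} (he : Function.Injective e)
    (ha : ∀ x, a x = e (f x)) {i : ℕ} (hi : t ≤ i) (j : ℕ) :
    powSpan K a b i j = Submodule.span K {g | ∃ m, ∃ l < j, fiberPow f b m l = g} := by
  apply le_antisymm
  · refine Submodule.span_le.2 ?_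
    rintro _ ⟨k, hk, l, hl, rfl⟩
    have : a ^ k * b ^ l = ∑ m, e m ^ k • fiberPow f b m l := by
      ext x
      simp [fiberPow, ha]
    rw [this]
    exact Submodule.sum_mem _ fun m _ =>
      Submodule.smul_mem _ _ (Submodule.subset_span ⟨m, l, hl, rfl⟩)
  · refine Submodule.span_le.2 ?_
    rintro _ ⟨m, l, hl, rfl⟩
    have hdeg : (Lagrange.basis Finset.univ e m).natDegree < i := by
      have := Lagrange.degree_basis (s := Finset.univ) (he.injOn) (Finset.mem_univ m)
      have h2 := Polynomial.natDegree_eq_of_degree_eq_some this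
      have := m.2
      simp at h2
      omega
    have : fiberPow f b m l = Polynomial.aeval a (Lagrange.basis Finset.univ e m) * b ^ l := by
      ext x
      have hx : (Polynomial.aeval a (Lagrange.basis Finset.univ e m)) x =
          (Lagrange.basis Finset.univ e m).eval (a x) := by
        simp
      rw [Pi.mul_apply, hx, ha]
      unfold fiberPow
      split_ifs with h
      · rw [h, Lagrange.eval_basis_self he.injOn (Finset.mem_univ _)]; simp
      · rw [Lagrange.eval_basis_of_ne (Ne.symm h) (Finset.mem_univ _), zero_mul]
    rw [this]
    exact aeval_mul_mem_powSpan a b _ hdeg hl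

theorem fiberPow_mem_span [Fintype Y] (m : Fin t) {l j : ℕ} (hl : l < j) :
    fiberPow f b m l ∈ Submodule.span K (Set.range
      fun s : Σ m, Fin (min j (Fintype.card {x // f x = m})) => fiberPow f b s.1 s.2) := by
  set q : Polynomial K := ∏ x : {x // f x = m}, (Polynomial.X - Polynomial.C (b x)) with hq
  have hqm : q.Monic := Polynomial.monic_prod_of_monic _ _ fun x _ => Polynomial.monic_X_sub_C _
  have hqd : q.natDegree = Fintype.card {x // f x = m} := by
    rw [hq, Polynomial.natDegree_prod_of_monic _ _ fun x _ => Polynomial.monic_X_sub_C _]; simp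
  rcases lt_or_ge l (Fintype.card {x // f x = m}) with h | h
  · exact Submodule.subset_span ⟨⟨m, l, by omega⟩, rfl⟩
  have hr : fiberPow f b m l = ∑ k : Fin (Fintype.card {x // f x = m}),
      (Polynomial.X ^ l %ₘ q).coeff k • fiberPow f b m k := by
    ext x
    rw [Finset.sum_apply]
    by_cases hx : f x = m
    · have h0 : q.eval (b x) = 0 := by
        rw [hq, Polynomial.eval_prod]
        exact Finset.prod_eq_zero (Finset.mem_univ ⟨x, hx⟩) (by simp)
      have h1 : (Polynomial.X ^ l %ₘ q).eval (b x) = b x ^ l := by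
        have := congrArg (Polynomial.eval (b x)) (Polynomial.modByMonic_add_div (Polynomial.X ^ l) q)
        simpa [h0] using this
      have h2 : (Polynomial.X ^ l %ₘ q).degree < (Fintype.card {x // f x = m} : ℕ) := by
        rw [← hqd, ← Polynomial.degree_eq_natDegree hqm.ne_zero]
        exact Polynomial.degree_modByMonic_lt _ hqm
      simp only [fiberPow, hx, if_true, Pi.smul_apply, smul_eq_mul]
      rw [← h1, Polynomial.eval_eq_sum_degreeLTEquiv (n := Fintype.card {x // f x = m})
        (Polynomial.mem_degreeLT.2 h2)]
      rfl
    · simp [fiberPow, hx]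
  rw [hr]
  exact Submodule.sum_mem _ fun k _ => Submodule.smul_mem _ _
    (Submodule.subset_span ⟨⟨m, k, by have := k.2; omega⟩, rfl⟩)

theorem linearIndependent_fiberPow [Fintype Y] (hb : ∀ x y, f x = f y → b x = b y → x = y) (j : ℕ) :
    LinearIndependent K
      fun s : Σ m, Fin (min j (Fintype.card {x // f x = m})) => fiberPow f b s.1 s.2 := by
  rw [Fintype.linearIndependent_iff]
  rintro g hg ⟨m, k⟩
  rw [Fintype.sum_sigma] at hg
  set p : Polynomial K := ∑ k : Fin (min j (Fintype.card {x // f x = m})),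
    Polynomial.monomial (k : ℕ) (g ⟨m, k⟩) with hp
  have hp0 : p = 0 := by
    refine Polynomial.eq_zero_of_natDegree_lt_card_of_eval_eq_zero p
      (f := fun x : {x // f x = m} => b x) ?_ ?_ ?_
    · rintro ⟨x, hx⟩ ⟨y, hy⟩ hxy
      exact Subtype.ext (hb x y (hx.trans hy.symm) hxy)
    · rintro ⟨x, hx⟩
      have := congrFun hg x
      rw [Finset.sum_apply, Finset.sum_eq_single m] at this
      · rw [hp, Polynomial.eval_finsetSum]
        simpa [fiberPow, hx] using this
      · intro m' _ hm'
        have : f x ≠ m' := by rw [hx]; exact hm'.symm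
        simp [fiberPow, this]
      · simp
    · have hk := k.2
      refine lt_of_le_of_lt (Polynomial.natDegree_sum_le_of_forall_le (n :=
        min j (Fintype.card {x // f x = m}) - 1) _ _ fun k' _ => ?_) (by omega)
      exact (Polynomial.natDegree_monomial_le _).trans (by have := k'.2; omega)
  have := congrArg (fun q => Polynomial.coeff q k) hp0
  simpa [hp, Polynomial.finsetSum_coeff, Polynomial.coeff_monomial, Fin.val_inj] using this

theorem finrank_powSpan_of_le [Fintype Y] {a : Y → K} {e : Fin t → K} (he : Function.Injective e)
    (ha : ∀ x, a x = e (f x)) (hb : ∀ x y, f x = f y → b x = b y → x = y)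
    {i : ℕ} (hi : t ≤ i) (j : ℕ) :
    Module.finrank K (powSpan K a b i j) = ∑ m, min j (Fintype.card {x // f x = m}) := by
  have : powSpan K a b i j = Submodule.span K (Set.range
      fun s : Σ m, Fin (min j (Fintype.card {x // f x = m})) => fiberPow f b s.1 s.2) := by
    rw [powSpan_eq_span_fiberPow f b he ha hi]
    apply le_antisymm
    · refine Submodule.span_le.2 ?_
      rintro _ ⟨m, l, hl, rfl⟩
      exact fiberPow_mem_span f b m hl
    · refine Submodule.span_le.2 ?_
      rintro _ ⟨⟨m, k⟩, rfl⟩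
      exact Submodule.subset_span ⟨m, k, by have := k.2; omega, rfl⟩
  rw [this, finrank_span_eq_card (linearIndependent_fiberPow f b hb j)]
  simp

end Fibers

theorem finrank_map_eq_of_ker_eq {K M N N' : Type*} [Field K] [AddCommGroup M] [Module K M]
    [AddCommGroup N] [Module K N] [AddCommGroup N'] [Module K N'] (S : Submodule K M)
    (g : M →ₗ[K] N) (h : M →ₗ[K] N') (hgh : ∀ x ∈ S, g x = 0 ↔ h x = 0) :
    Module.finrank K (S.map g) = Module.finrank K (S.map h) := by
  have hk : LinearMap.ker (g ∘ₗ S.subtype) = LinearMap.ker (h ∘ₗ S.subtype) := by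
    ext x
    simpa using hgh x x.2
  have e := (LinearMap.quotKerEquivRange (g ∘ₗ S.subtype)).symm.trans
    ((Submodule.quotEquivOfEq _ _ hk).trans (LinearMap.quotKerEquivRange (h ∘ₗ S.subtype)))
  rw [LinearMap.range_comp, LinearMap.range_comp, Submodule.range_subtype] at e
  exact e.finrank_eq

section Dehomogenization

variable {K A : Type} [Field K] [CommRing A] [Algebra K A]
variable (a : Fin 2 → A) (c : Fin 2 → K)

/-- Affine coordinates in which the forms `x_{i,0} + c i * x_{i,1}` become `1`. -/
def affineCoord (s : Sig 2 (fun _ => 1)) : A := if s.2 = 0 then 1 - c s.1 • a s.1 else a s.1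

/-- The bigraded homomorphism given by the affine coordinates, with two additional variables
recording the degree. -/
def bigradedEval : R2 K →ₐ[K] MvPolynomial (Fin 2) A :=
  aeval fun s => C (affineCoord a c s) * X s.1

/-- The linear form `x_{i,0} + c i * x_{i,1}`. -/
def linForm (i : Fin 2) : R2 K := X ⟨i, 0⟩ + C (c i) * X ⟨i, 1⟩

theorem bigradedEval_X (s : Sig 2 (fun _ => 1)) :
    bigradedEval a c (X s) = C (affineCoord a c s) * X s.1 := by
  simp [bigradedEval]

theorem bigradedEval_X_one (i : Fin 2) :
    bigradedEval a c (X ⟨i, 1⟩) = C (a i) * X i := by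
  simp [bigradedEval_X, affineCoord]

theorem bigradedEval_linForm (i : Fin 2) : bigradedEval a c (linForm c i) = X i := by
  have : bigradedEval a c (C (c i)) = C (algebraMap K A (c i)) := by
    rw [← algebraMap_eq, AlgHom.commutes]; rfl
  simp only [linForm, map_add, map_mul, bigradedEval_X, this, affineCoord]
  simp only [if_true, Algebra.smul_def, map_sub, map_one, map_mul]
  simp
  ring

theorem coeff_bigradedEval_mem (F : R2 K) (d : Fin 2 →₀ ℕ) :
    coeff d (bigradedEval a c F) ∈ powSpan K (a 0) (a 1) (d 0 + 1) (d 1 + 1) := by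
  classical
  induction F using MvPolynomial.induction_on generalizing d with
  | C r =>
    rw [← algebraMap_eq, AlgHom.commutes, MvPolynomial.algebraMap_apply, coeff_C]
    split_ifs
    · rw [Algebra.algebraMap_eq_smul_one]
      refine Submodule.smul_mem _ _ ?_
      simpa using pow_mul_pow_mem_powSpan (K := K) (a 0) (a 1)
        (Nat.succ_pos (d 0)) (Nat.succ_pos (d 1))
    · exact Submodule.zero_mem _
  | add p q hp hq => rw [map_add, coeff_add]; exact add_mem (hp d) (hq d)
  | mul_X p s hp =>
    have e : bigradedEval a c p * (C (affineCoord a c s) * X s.1) =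
        (C (affineCoord a c s) * bigradedEval a c p) * X s.1 := by ring
    rw [map_mul, bigradedEval_X, e, coeff_mul_X', coeff_C_mul]
    split_ifs with hs
    · have hx := hp (d - Finsupp.single s.1 1)
      have hd : d s.1 ≠ 0 := Finsupp.mem_support_iff.1 hs
      set x := coeff (d - Finsupp.single s.1 1) (bigradedEval a c p)
      have key : a s.1 * x ∈ powSpan K (a 0) (a 1) (d 0 + 1) (d 1 + 1) ∧
          x ∈ powSpan K (a 0) (a 1) (d 0 + 1) (d 1 + 1) := by
        refine ⟨?_, powSpan_mono _ _ (by simp) (by simp) hx⟩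
        obtain ⟨s0, s1⟩ := s
        fin_cases s0
        · have h := mul_left_mem_powSpan _ _ hx
          simp at h hd
          rwa [Nat.sub_add_cancel (Nat.pos_of_ne_zero hd)] at h
        · have h := mul_right_mem_powSpan _ _ hx
          simp at h hd
          rwa [Nat.sub_add_cancel (Nat.pos_of_ne_zero hd)] at h
      unfold affineCoord
      split_ifs
      · rw [sub_mul, one_mul, smul_mul_assoc]
        exact sub_mem key.2 (Submodule.smul_mem _ _ key.1)
      · exact key.1
    · exact Submodule.zero_mem _

theorem exists_bigradedEval_eq_monomial {i j : ℕ} {g : A}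
    (hg : g ∈ powSpan K (a 0) (a 1) (i + 1) (j + 1)) :
    ∃ F ∈ weightedHomogeneousSubmodule K (wt 2 fun _ => 1) ![i, j],
      bigradedEval a c F = monomial (Finsupp.equivFunOnFinite.symm ![i, j]) g := by
  induction hg using Submodule.span_induction with
  | mem x h =>
    obtain ⟨k, hk, l, hl, rfl⟩ := h
    have hL : ∀ i, IsWeightedHomogeneous (wt 2 fun _ => 1) (linForm c i) (Pi.single i 1) :=
      fun i => (isWeightedHomogeneous_X K (wt 2 fun _ => 1) _).add (by
        have := (isWeightedHomogeneous_C (wt 2 fun _ => 1) (c i)).mul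
          (isWeightedHomogeneous_X K (wt 2 fun _ => 1) (⟨i, 1⟩ : Sig 2 fun _ => 1))
        rwa [zero_add] at this)
    have hX : ∀ i, IsWeightedHomogeneous (wt 2 fun _ => 1)
        (X ⟨i, 1⟩ : R2 K) (Pi.single i 1) :=
      fun i => isWeightedHomogeneous_X K (wt 2 fun _ => 1) _
    refine ⟨linForm c 0 ^ (i - k) * X ⟨0, 1⟩ ^ k * (linForm c 1 ^ (j - l) * X ⟨1, 1⟩ ^ l), ?_, ?_⟩
    · rw [mem_weightedHomogeneousSubmodule]
      convert (((hL 0).pow (i - k)).mul ((hX 0).pow k)).mul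
        (((hL 1).pow (j - l)).mul ((hX 1).pow l)) using 1
      ext s
      fin_cases s <;> simp <;> omega
    · simp only [map_mul, map_pow, bigradedEval_linForm, bigradedEval_X_one]
      have : (monomial (Finsupp.equivFunOnFinite.symm ![i, j]) (a 0 ^ k * a 1 ^ l) :
          MvPolynomial (Fin 2) A) = C (a 0 ^ k * a 1 ^ l) * (X 0 ^ i * X 1 ^ j) := by
        rw [monomial_eq, Finsupp.prod_fintype _ _ (by simp)]
        simp
      obtain ⟨i', rfl⟩ := Nat.exists_eq_add_of_le (Nat.lt_succ_iff.1 hk)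
      obtain ⟨j', rfl⟩ := Nat.exists_eq_add_of_le (Nat.lt_succ_iff.1 hl)
      rw [this]
      simp only [Nat.add_sub_cancel_left, map_mul, map_pow]
      ring
  | zero => exact ⟨0, Submodule.zero_mem _, by simp⟩
  | add x y _ _ hx hy =>
    obtain ⟨F, hF, hF'⟩ := hx
    obtain ⟨G, hG, hG'⟩ := hy
    exact ⟨F + G, add_mem hF hG, by rw [map_add, hF', hG', map_add]⟩
  | smul r x _ hx =>
    obtain ⟨F, hF, hF'⟩ := hx
    exact ⟨r • F, Submodule.smul_mem _ _ hF, by rw [map_smul, hF', smul_monomial]⟩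

theorem coeff_bigradedEval_eq_zero {F : R2 K} {d : Fin 2 → ℕ}
    (hF : F ∈ weightedHomogeneousSubmodule K (wt 2 fun _ => 1) d) {e : Fin 2 →₀ ℕ}
    (he : ⇑e ≠ d) : coeff e (bigradedEval a c F) = 0 := by
  classical
  have hprod : ∀ m : Sig 2 (fun _ => 1) →₀ ℕ, ∃ q : A,
      (m.prod fun s n => (C (affineCoord a c s) * X s.1 : MvPolynomial (Fin 2) A) ^ n) =
        monomial (Finsupp.equivFunOnFinite.symm (Finsupp.weight (wt 2 fun _ => 1) m)) q := by
    intro m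
    induction m using Finsupp.induction_linear with
    | zero =>
      refine ⟨1, ?_⟩
      have : Finsupp.equivFunOnFinite.symm (0 : Fin 2 → ℕ) = 0 := by ext; simp
      simp [this]
    | add m m' h h' =>
      obtain ⟨q, hq⟩ := h
      obtain ⟨q', hq'⟩ := h'
      refine ⟨q * q', ?_⟩
      rw [Finsupp.prod_add_index' (by simp) (by intros; rw [pow_add]), hq, hq', monomial_mul]
      congr 2
      ext; simp
    | single s n =>
      refine ⟨affineCoord a c s ^ n, ?_⟩
      rw [Finsupp.prod_single_index (by simp), mul_pow, ← map_pow, X_pow_eq_monomial,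
        C_mul_monomial, mul_one, Finsupp.weight_single]
      congr 2
      ext i
      simp [wt, Finsupp.single_apply, Pi.single_apply, eq_comm]
  rw [F.as_sum, map_sum, coeff_sum]
  refine Finset.sum_eq_zero fun m hm => ?_
  obtain ⟨q, hq⟩ := hprod m
  rw [bigradedEval, aeval_monomial, hq, MvPolynomial.algebraMap_apply, coeff_C_mul, coeff_monomial,
    if_neg, mul_zero]
  rintro rfl
  exact he ((mem_weightedHomogeneousSubmodule K _ _ _).1 hF (mem_support_iff.1 hm))

theorem hilb_eq_finrank_powSpan {I : Ideal (R2 K)}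
    (hI : RingHom.ker (bigradedEval a c) = I) (i j : ℕ) :
    hilb K 2 (fun _ => 1) I ![i, j] =
      Module.finrank K (powSpan K (a 0) (a 1) (i + 1) (j + 1)) := by
  set d := Finsupp.equivFunOnFinite.symm ![i, j] with hd
  set h : R2 K →ₗ[K] A :=
    (lcoeff A d).restrictScalars K ∘ₗ (bigradedEval a c).toLinearMap with hh
  have hmap : (weightedHomogeneousSubmodule K (wt 2 fun _ => 1) ![i, j]).map h =
      powSpan K (a 0) (a 1) (i + 1) (j + 1) := by
    apply le_antisymm
    · rintro _ ⟨F, _, rfl⟩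
      exact coeff_bigradedEval_mem a c F d
    · intro g hg
      obtain ⟨F, hF, hFg⟩ := exists_bigradedEval_eq_monomial a c hg
      refine ⟨F, hF, ?_⟩
      change coeff d (bigradedEval a c F) = g
      rw [hFg, coeff_monomial, if_pos rfl]
  rw [hilb, ← hmap]
  refine finrank_map_eq_of_ker_eq _ _ _ fun F hF => ?_
  change Ideal.Quotient.mk I F = 0 ↔ coeff d (bigradedEval a c F) = 0
  rw [Ideal.Quotient.eq_zero_iff_mem, ← hI, RingHom.mem_ker]
  constructor
  · intro h0
    rw [h0, coeff_zero]
  · intro h0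
    ext e
    rw [coeff_zero]
    by_cases he : e = d
    · rw [he, h0]
    · refine coeff_bigradedEval_eq_zero a c hF fun he' => he ?_
      rw [hd, ← he']
      ext; simp

theorem X_mul_eq_zero {i : Fin 2} {x : MvPolynomial (Fin 2) A} (h : X i * x = 0) : x = 0 := by
  ext d
  have := congrArg (coeff (Finsupp.single i 1 + d)) h
  rwa [coeff_X_mul] at this

/-- If `x_{i,0} + c i * x_{i,1}`, `i = 0, 1`, is a regular sequence on the image of
`bigradedEval a c`, then the spaces `powSpan K (a 0) (a 1) i j` intersect as expected. -/
theorem powSpan_inf_le_of_regular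
    (h : ∀ G, linForm c 1 * G ∈ RingHom.ker (bigradedEval a c) ⊔ Ideal.span {linForm c 0} →
      G ∈ RingHom.ker (bigradedEval a c) ⊔ Ideal.span {linForm c 0}) (i j : ℕ) :
    powSpan K (a 0) (a 1) i (j + 1) ⊓ powSpan K (a 0) (a 1) (i + 1) j ≤
      powSpan K (a 0) (a 1) i j := by
  rcases i with _ | i
  · exact inf_le_left.trans (by rw [powSpan_zero_left, powSpan_zero_left])
  rcases j with _ | j
  · exact inf_le_right.trans (by rw [powSpan_zero_right, powSpan_zero_right])
  rintro g ⟨hg₁, hg₂⟩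
  obtain ⟨G₁, -, hG₁⟩ := exists_bigradedEval_eq_monomial a c hg₁
  obtain ⟨G₂, -, hG₂⟩ := exists_bigradedEval_eq_monomial a c hg₂
  have hd₁ : Finsupp.single 0 1 + Finsupp.equivFunOnFinite.symm ![i, j] =
      Finsupp.equivFunOnFinite.symm ![i + 1, j] := by
    ext s; fin_cases s <;> simp [add_comm]
  have hd : Finsupp.single 1 1 + Finsupp.equivFunOnFinite.symm ![i + 1, j] =
      Finsupp.single 0 1 + Finsupp.equivFunOnFinite.symm ![i, j + 1] := by
    ext s; fin_cases s <;> simp [add_comm]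
  have hG : bigradedEval a c (linForm c 1 * G₂) =
      bigradedEval a c (linForm c 0) * bigradedEval a c G₁ := by
    rw [map_mul, bigradedEval_linForm, bigradedEval_linForm, hG₁, hG₂, X, X, monomial_mul,
      monomial_mul, hd]
  have hG' := h G₂ ((mem_ker_sup_span_singleton (bigradedEval a c) _ _).2 ⟨G₁, hG⟩)
  obtain ⟨H, hH⟩ := (mem_ker_sup_span_singleton (bigradedEval a c) _ _).1 hG'
  simp only [bigradedEval_linForm, hG₂] at hH
  have := congrArg (coeff (Finsupp.equivFunOnFinite.symm ![i + 1, j])) hH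
  rw [coeff_monomial, if_pos rfl, ← hd₁, coeff_X_mul] at this
  rw [this]
  simpa using coeff_bigradedEval_mem a c H (Finsupp.equivFunOnFinite.symm ![i, j])

theorem exists_pow_mem_ker_sup_span [FiniteDimensional K A] (i : Fin 2) :
    ∃ N, (X ⟨i, 1⟩ : R2 K) ^ N ∈
      RingHom.ker (bigradedEval a c) ⊔ Ideal.span {linForm c i} := by
  obtain ⟨p, hp, hpa⟩ := Algebra.IsIntegral.isIntegral (R := K) (a i)
  refine ⟨p.natDegree, (mem_ker_sup_span_singleton (bigradedEval a c) _ _).2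
    ⟨-∑ k ∈ Finset.range p.natDegree,
      C (p.coeff k) * X ⟨i, 1⟩ ^ k * linForm c i ^ (p.natDegree - 1 - k), ?_⟩⟩
  have hC : ∀ r : K, bigradedEval a c (C r) = C (algebraMap K A r) := fun r => by
    rw [← algebraMap_eq, AlgHom.commutes]; rfl
  rw [Polynomial.eval₂_eq_sum_range, Finset.sum_range_succ, hp.coeff_natDegree, map_one,
    one_mul] at hpa
  simp only [map_neg, map_sum, map_mul, map_pow, bigradedEval_linForm,
    bigradedEval_X_one, hC, mul_neg, Finset.mul_sum]
  rw [mul_pow, ← map_pow, eq_neg_of_add_eq_zero_right hpa, map_neg, map_sum, neg_mul,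
    Finset.sum_mul]
  refine congrArg Neg.neg (Finset.sum_congr rfl fun k hk => ?_)
  have hk' : p.natDegree = k + (p.natDegree - 1 - k) + 1 := by
    have := Finset.mem_range.1 hk; omega
  conv_lhs => rw [hk']
  simp only [map_mul, map_pow]
  ring

theorem maxIdeal_le_span :
    maxIdeal K 2 (fun _ => 1) ≤
      Ideal.span {linForm c 0, X ⟨0, 1⟩, linForm c 1, X ⟨1, 1⟩} := by
  refine Ideal.span_le.2 ?_
  have h1 : ∀ i, (X ⟨i, 1⟩ : R2 K) ∈
      Ideal.span {linForm c 0, X ⟨0, 1⟩, linForm c 1, X ⟨1, 1⟩} := fun i =>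
    Ideal.subset_span (by fin_cases i <;> simp)
  have h0 : ∀ i, linForm c i ∈
      Ideal.span {linForm c 0, X ⟨0, 1⟩, linForm c 1, X ⟨1, 1⟩} := fun i =>
    Ideal.subset_span (by fin_cases i <;> simp)
  rintro _ ⟨⟨i, j⟩, rfl⟩
  have hj : j = 0 ∨ j = 1 := by
    change Fin 2 at j
    fin_cases j <;> simp
  rcases hj with rfl | rfl
  · have : (X ⟨i, 0⟩ : R2 K) = linForm c i - C (c i) * X ⟨i, 1⟩ := by simp [linForm]
    rw [this]
    exact Ideal.sub_mem _ (h0 i) (Ideal.mul_mem_left _ _ (h1 i))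
  · exact h1 i

theorem linForm_regular_of_hasDepth_two [FiniteDimensional K A] {I : Ideal (R2 K)}
    (hI : RingHom.ker (bigradedEval a c) = I) (hdepth : hasDepth K 2 (fun _ => 1) I 2)
    {G : R2 K} (hG : linForm c 1 * G ∈ RingHom.ker (bigradedEval a c) ⊔ Ideal.span {linForm c 0}) :
    G ∈ RingHom.ker (bigradedEval a c) ⊔ Ideal.span {linForm c 0} := by
  subst hI
  obtain ⟨⟨L, hL, hLm, hLr⟩, -⟩ := hdepth
  obtain ⟨F₁, F₂, rfl⟩ := List.length_eq_two.1 hL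
  have hr₁ := hLr ⟨0, by simp⟩
  have hr₂ := hLr ⟨1, by simp⟩
  simp [-RingHom.mem_ker, -map_mul] at hr₁ hr₂
  have hF : ∀ F ∈ [F₁, F₂], F ∈ maxIdeal K 2 (fun _ => 1) := fun F hF =>
    hLm (Submodule.mem_sup_right (Ideal.subset_span hF))
  obtain ⟨M, hM⟩ := exists_pow_mem_ker_sup_span a c 0
  obtain ⟨N, hN⟩ := exists_pow_mem_ker_sup_span a c 1
  have hs : ∀ F, F₁ * F ∈ RingHom.ker (bigradedEval a c) ⊔ Ideal.span {linForm c 0} →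
      F₂ * F ∈ RingHom.ker (bigradedEval a c) ⊔ Ideal.span {linForm c 0} →
      F ∈ RingHom.ker (bigradedEval a c) ⊔ Ideal.span {linForm c 0} := fun F h₁ h₂ =>
    mem_ker_sup_span_of_regular (bigradedEval a c) hr₁ hr₂
      (fun x hx => X_mul_eq_zero (i := 0) (by rwa [bigradedEval_linForm] at hx)) h₁ h₂
  have h0 : linForm c 0 ∈ RingHom.ker (bigradedEval a c) ⊔ Ideal.span {linForm c 0} :=
    Submodule.mem_sup_right (Ideal.mem_span_singleton_self _)
  have hN' := sup_le_sup_right (c := Ideal.span {linForm c 1})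
    (le_sup_left (a := RingHom.ker (bigradedEval a c)) (b := Ideal.span {linForm c 0})) hN
  generalize RingHom.ker (bigradedEval a c) ⊔ Ideal.span {linForm c 0} = J at *
  refine mem_of_mul_mem_of_socle_eq_bot h0 hM hN' (fun F hF' => ?_) hG
  have hall : maxIdeal K 2 (fun _ => 1) ≤ J.colon {F} :=
    (maxIdeal_le_span c).trans (Ideal.span_le.2 fun F' hF =>
      Submodule.mem_colon_singleton.2 (hF' F' hF))
  exact hs F (Submodule.mem_colon_singleton.1 (hall (hF F₁ (by simp))))
    (Submodule.mem_colon_singleton.1 (hall (hF F₂ (by simp))))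

end Dehomogenization

section Points

variable {K : Type} [Field K]

/-- The affine coordinate `y / (x + r * y)` of the point `[x : y]` of `ℙ^1`. -/
def chart (r : K) (p : Proj1 K) : K := p.rep 1 / (p.rep 0 + r * p.rep 1)

theorem eq_of_chart_eq {r : K} {p q : Proj1 K} (hp : p.rep 0 + r * p.rep 1 ≠ 0)
    (hq : q.rep 0 + r * q.rep 1 ≠ 0) (h : chart r p = chart r q) : p = q := by
  unfold chart at h
  rw [div_eq_div_iff hp hq] at h
  rw [← p.mk_rep, ← q.mk_rep, Projectivization.mk_eq_mk_iff']
  refine ⟨(p.rep 0 + r * p.rep 1) / (q.rep 0 + r * q.rep 1), ?_⟩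
  ext s
  rw [Pi.smul_apply, smul_eq_mul, div_mul_eq_mul_div, div_eq_iff hq]
  fin_cases s
  · simp only [Fin.zero_eta]
    linear_combination r * h
  · simp only [Fin.mk_one]
    linear_combination -h

theorem exists_add_mul_rep_ne_zero [Infinite K] {S : Set (Proj1 K)} (hS : S.Finite) :
    ∃ r : K, ∀ p ∈ S, p.rep 0 + r * p.rep 1 ≠ 0 := by
  obtain ⟨r, hr⟩ := (hS.image fun p => -p.rep 0 / p.rep 1).exists_notMem
  refine ⟨r, fun p hp h => ?_⟩
  by_cases h1 : p.rep 1 = 0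
  · refine p.rep_nonzero ?_
    ext s
    fin_cases s
    · simpa [h1] using h
    · exact h1
  · exact hr ⟨p, hp, by dsimp only; rw [div_eq_iff h1]; linear_combination -h⟩

theorem eval_map_bigradedEval {Y : Type} (a : Fin 2 → Y → K) (c : Fin 2 → K) (F : R2 K) (x : Y)
    (r : Fin 2 → K) :
    eval r (map (Pi.evalRingHom (fun _ : Y => K) x) (bigradedEval a c F)) =
      eval (fun s => r s.1 * affineCoord a c s x) F := by
  induction F using MvPolynomial.induction_on with
  | C r =>
    rw [← algebraMap_eq, AlgHom.commutes, MvPolynomial.algebraMap_apply]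
    simp
  | add p q hp hq => simp only [map_add, hp, hq]
  | mul_X p s hp =>
    rw [map_mul, map_mul, map_mul, hp, bigradedEval_X, map_mul, map_mul, map_C, map_X, eval_C,
      eval_X, map_mul, eval_X, mul_comm (r s.1)]
    rfl

theorem bigradedEval_eq_zero_iff [Infinite K] {Y : Type} (a : Fin 2 → Y → K) (c : Fin 2 → K)
    (F : R2 K) : bigradedEval a c F = 0 ↔
      ∀ (x : Y) (r : Fin 2 → K), eval (fun s => r s.1 * affineCoord a c s x) F = 0 := by
  constructor
  · intro h x r
    rw [← eval_map_bigradedEval, h, map_zero, map_zero]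
  · intro h
    ext d x
    have h0 : map (Pi.evalRingHom (fun _ : Y => K) x) (bigradedEval a c F) = 0 :=
      MvPolynomial.funext fun r => by rw [eval_map_bigradedEval, h, map_zero]
    have := congrArg (coeff d) h0
    rwa [coeff_map] at this

theorem ker_bigradedEval_eq_idealOfSet [Infinite K] {X : Set (Pt2 K)} {c : Fin 2 → K}
    (hc : ∀ i, ∀ Z ∈ X, (Z i).rep 0 + c i * (Z i).rep 1 ≠ 0) :
    RingHom.ker (bigradedEval (fun i (Z : X) => chart (c i) (Z.1 i)) c) =
      idealOfSet K 2 (fun _ => 1) X := by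
  ext F
  rw [RingHom.mem_ker, bigradedEval_eq_zero_iff]
  simp only [idealOfSet, idealOfPoint, vanishingIdeal, Ideal.mem_iInf, RingHom.mem_ker, cone,
    Set.mem_ofPred_eq]
  have hw : ∀ (Z : X) (s : Sig 2 fun _ => 1),
      ((Z.1 s.1).rep 0 + c s.1 * (Z.1 s.1).rep 1) *
        affineCoord (fun i (Z : X) => chart (c i) (Z.1 i)) c s Z = (Z.1 s.1).rep s.2 := by
    rintro Z ⟨i, j⟩
    have := hc i Z.1 Z.2
    change Fin 2 at j
    fin_cases j
    · simp [affineCoord, chart]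
      field_simp
      ring
    · simp [affineCoord, chart]
      field_simp
  constructor
  · intro h Z hZ y hy
    choose r hr using hy
    have := h ⟨Z, hZ⟩ fun i => r i * ((Z i).rep 0 + c i * (Z i).rep 1)
    convert this using 2
    refine congrArg _ (_root_.funext fun s => ?_)
    rw [mul_assoc, hw ⟨Z, hZ⟩ s]
    exact congrFun (hr s.1) s.2
  · intro h Z r
    refine h Z.1 Z.2 _ fun i => ⟨r i / ((Z.1 i).rep 0 + c i * (Z.1 i).rep 1), ?_⟩
    ext j
    rw [Pi.smul_apply, smul_eq_mul, ← hw Z ⟨i, j⟩, div_mul_eq_mul_div,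
      eq_div_iff (hc i Z.1 Z.2)]
    ring

end Points

/-- the Hilbert function of an ACM set of points of `ℙ^1 × ℙ^1` is
`H_X(i,j) = Σ_{m=1}^{min(i+1,t)} min(j+1, α_m)`. -/
theorem statement_19 (K : Type) [Field K] [IsAlgClosed K] [CharZero K]
    (X : Set (Pt2 K)) (hX : X.Finite) (t : ℕ)
    (P : Fin t → Proj1 K) (α : Fin t → ℕ) (hα : IsAlphaLabel K X P α)
    (hACM : IsACM K 2 (fun _ => 1) X) :
    ∀ i j : ℕ,
      hilb K 2 (fun _ => 1) (idealOfSet K 2 (fun _ => 1) X) ![i, j] =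
        ∑ m ∈ Finset.range (min (i + 1) t),
          min (j + 1) (if h : m < t then α ⟨m, h⟩ else 0) := by
  classical
  obtain ⟨hP, hPX, hcard, hanti⟩ := hα
  have := hX.fintype
  choose c hc using fun i : Fin 2 =>
    exists_add_mul_rep_ne_zero (hX.image fun Z : Pt2 K => Z i)
  replace hc : ∀ i, ∀ Z ∈ X, (Z i).rep 0 + c i * (Z i).rep 1 ≠ 0 := fun i Z hZ =>
    hc i _ ⟨Z, hZ, rfl⟩
  set a : Fin 2 → X → K := fun i Z => chart (c i) (Z.1 i) with ha
  have hker := ker_bigradedEval_eq_idealOfSet hc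
  have hPc : ∀ m, (P m).rep 0 + c 0 * (P m).rep 1 ≠ 0 := by
    intro m
    obtain ⟨Z, hZ, h⟩ := hPX.subset ⟨m, rfl⟩
    rw [← h]
    exact hc 0 Z hZ
  have hf : ∀ Z : X, ∃ m, P m = Z.1 0 := fun Z => hPX.superset ⟨Z, Z.2, rfl⟩
  choose f hf using hf
  have hα : ∀ m, Fintype.card {Z // f Z = m} = α m := by
    intro m
    rw [hcard, ← Nat.card_coe_set_eq, ← Nat.card_eq_fintype_card]
    refine Nat.card_congr
      { toFun := fun Z => ⟨Z.1.1, Z.1.2, by rw [← hf, Z.2]⟩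
        invFun := fun Z => ⟨⟨Z.1, Z.2.1⟩, hP (by rw [hf, Z.2.2])⟩
        left_inv := fun _ => rfl
        right_inv := fun _ => rfl }
  intro i j
  rw [hilb_eq_finrank_powSpan a c hker]
  refine finrank_powSpan_eq_sum_min (a 0) (a 1)
    (powSpan_inf_le_of_regular a c fun _ => linForm_regular_of_hasDepth_two a c hker hACM)
    hanti (fun i j hi => ?_) (i + 1) (j + 1)
  rw [finrank_powSpan_of_le f (a 1) (e := fun m => chart (c 0) (P m))
    (fun m m' h => hP (eq_of_chart_eq (hPc m) (hPc m') h)) (fun Z => by rw [hf]) ?_ hi]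
  · simp only [hα]
  · intro Z Z' h0 h1
    refine Subtype.ext (_root_.funext fun s => ?_)
    fin_cases s
    · exact (hf Z).symm.trans ((congrArg P h0).trans (hf Z'))
    · exact eq_of_chart_eq (hc 1 Z Z.2) (hc 1 Z' Z'.2) h1

end PaperMP
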